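/- arXiv:2105.07301 — 2 statements merged into one kernel-verified Lean document; each statement's English description precedes it below -/
import Mathlib

section
/- Let n be a natural number, let Fy, Hy be n×n complex matrices, let K₁, K₂, K₃ be n×n diagonal matrices with real diagonal entries (viewed as complex matrices), and let e, eA, eB ∈ ℂⁿ. Define ė = Fy·eA + Hy·eB − K₁·e − K₂·eA − K₃·eB, ėA = −(Fy)ᴴ·e + K₂·e, and ėB = −(Hy)ᴴ·e + K₃·e, where Mᴴ denotes the conjugate transpose of M. Then Re⟪e, ė⟫ + Re⟪eA, ėA⟫ + Re⟪eB, ėB⟫ = −Re⟪e, K₁·e⟫, where ⟪·,·⟫ is the standard Hermitian inner product on ℂⁿ. -/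
open Matrix

/-- Moving a matrix across the Hermitian inner product does not change the real part. -/
lemma re_star_dotProduct_conjTranspose_mulVec {m n : Type*} [Fintype m] [Fintype n]
    (M : Matrix m n ℂ) (x : n → ℂ) (y : m → ℂ) :
    (star x ⬝ᵥ Mᴴ.mulVec y).re = (star y ⬝ᵥ M.mulVec x).re := by
  rw [dotProduct_mulVec, ← star_mulVec, star_dotProduct, Complex.star_def, Complex.conj_re]

/-- A diagonal matrix with real entries is Hermitian. -/
lemma conjTranspose_diagonal_ofReal {n : Type*} [DecidableEq n] (k : n → ℝ) :
    (Matrix.diagonal fun i => (k i : ℂ))ᴴ = Matrix.diagonal fun i => (k i : ℂ) := by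
  rw [diagonal_conjTranspose]
  congr 1
  ext i
  simp

/-- The Lyapunov-derivative identity: with the controlled error dynamics
`ė = Fy·eA + Hy·eB − K₁e − K₂eA − K₃eB` and the parameter-update laws
`ėA = −Fyᴴe + K₂e`, `ėB = −Hyᴴe + K₃e`, where `K₁, K₂, K₃` are diagonal matrices with
real diagonal entries, one has
`Re⟪e, ė⟫ + Re⟪eA, ėA⟫ + Re⟪eB, ėB⟫ = −Re⟪e, K₁e⟫`,
where `⟪x, y⟫ = ∑ i, conj (x i) * y i = (star x) ⬝ᵥ y` is the Hermitian inner product. -/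
theorem lyapunov_derivative_identity (n : ℕ)
    (Fy Hy : Matrix (Fin n) (Fin n) ℂ)
    (k₁ k₂ k₃ : Fin n → ℝ)
    (K₁ K₂ K₃ : Matrix (Fin n) (Fin n) ℂ)
    (hK₁ : K₁ = Matrix.diagonal fun i => (k₁ i : ℂ))
    (hK₂ : K₂ = Matrix.diagonal fun i => (k₂ i : ℂ))
    (hK₃ : K₃ = Matrix.diagonal fun i => (k₃ i : ℂ))
    (e eA eB de deA deB : Fin n → ℂ)
    (hde : de = Fy.mulVec eA + Hy.mulVec eB - K₁.mulVec e - K₂.mulVec eA - K₃.mulVec eB)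
    (hdeA : deA = -(Fyᴴ.mulVec e) + K₂.mulVec e)
    (hdeB : deB = -(Hyᴴ.mulVec e) + K₃.mulVec e) :
    (star e ⬝ᵥ de).re + (star eA ⬝ᵥ deA).re + (star eB ⬝ᵥ deB).re
      = -(star e ⬝ᵥ K₁.mulVec e).re := by
  have h₂ := re_star_dotProduct_conjTranspose_mulVec K₂ eA e
  have h₃ := re_star_dotProduct_conjTranspose_mulVec K₃ eB e
  rw [hK₂, conjTranspose_diagonal_ofReal, ← hK₂] at h₂
  rw [hK₃, conjTranspose_diagonal_ofReal, ← hK₃] at h₃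
  rw [hde, hdeA, hdeB]
  simp only [dotProduct_add, dotProduct_sub, dotProduct_neg, Complex.add_re, Complex.sub_re,
    Complex.neg_re, re_star_dotProduct_conjTranspose_mulVec, h₂, h₃]
  ring
end

section
/- Let n be a natural number, let F, H : ℝ → Matrix (Fin n) (Fin n) ℂ, and let K₁, K₂, K₃ be n×n diagonal matrices with real diagonal entries such that the diagonal entries of K₁ are positive. Suppose e, eA, eB : ℝ → ℂⁿ are differentiable and satisfy the controlled error dynamics e′(t) = F(t)·eA(t) + H(t)·eB(t) − K₁·e(t) − K₂·eA(t) − K₃·eB(t), eA′(t) = −(F(t))ᴴ·e(t) + K₂·e(t), eB′(t) = −(H(t))ᴴ·e(t) + K₃·e(t). Then for every t ≥ 0, ‖e(t)‖² + ‖eA(t)‖² + ‖eB(t)‖² ≤ ‖e(0)‖² + ‖eA(0)‖² + ‖eB(0)‖²; in particular all three error trajectories are bounded on [0, ∞). -/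
open Matrix

/-- Matrix–vector multiplication on the Euclidean space `ℂⁿ`. -/
noncomputable def mulVecE {n : ℕ} (M : Matrix (Fin n) (Fin n) ℂ)
    (v : EuclideanSpace ℂ (Fin n)) : EuclideanSpace ℂ (Fin n) :=
  Matrix.toEuclideanLin M v

/-- The real inner product on `ℂⁿ` is the real part of the Hermitian one. -/
lemma euclidean_real_inner_eq_re_inner {n : ℕ} (x y : EuclideanSpace ℂ (Fin n)) :
    inner ℝ x y = (inner ℂ x y).re := by
  simp [PiLp.inner_apply]

/-- The Hermitian transpose is the adjoint for the real inner product underlying `ℂⁿ`. -/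
lemma real_inner_mulVecE_conjTranspose {n : ℕ} (M : Matrix (Fin n) (Fin n) ℂ)
    (x y : EuclideanSpace ℂ (Fin n)) :
    inner ℝ x (mulVecE Mᴴ y) = inner ℝ y (mulVecE M x) := by
  refine (real_inner_comm _ _).trans ?_
  simp only [euclidean_real_inner_eq_re_inner, mulVecE, Matrix.toEuclideanLin_conjTranspose_eq_adjoint,
    LinearMap.adjoint_inner_left]

lemma real_inner_mulVecE_comm_of_isHermitian {n : ℕ} {M : Matrix (Fin n) (Fin n) ℂ}
    (hM : M.IsHermitian) (x y : EuclideanSpace ℂ (Fin n)) :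
    inner ℝ x (mulVecE M y) = inner ℝ y (mulVecE M x) := by
  simpa only [hM.eq] using real_inner_mulVecE_conjTranspose M x y

lemma isHermitian_diagonal_ofReal {n : ℕ} (k : Fin n → ℝ) :
    (Matrix.diagonal fun i => (k i : ℂ)).IsHermitian :=
  Matrix.isHermitian_diagonal_of_self_adjoint _ (by ext i; simp)

lemma real_inner_mulVecE_diagonal_self_nonneg {n : ℕ} {k : Fin n → ℝ} (hk : ∀ i, 0 ≤ k i)
    (x : EuclideanSpace ℂ (Fin n)) :
    0 ≤ inner ℝ x (mulVecE (Matrix.diagonal fun i => (k i : ℂ)) x) := by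
  rw [PiLp.inner_apply]
  refine Finset.sum_nonneg fun i _ => ?_
  have h : (mulVecE (Matrix.diagonal fun i => (k i : ℂ)) x) i = k i • x i := by
    simp [mulVecE, Matrix.toLpLin_apply, Matrix.mulVec_diagonal]
  rw [h, real_inner_smul_right, real_inner_self_eq_norm_sq]
  exact mul_nonneg (hk i) (sq_nonneg _)

/-- Along solutions of the controlled error dynamics with the adaptive parameter-update laws,
for every `t ≥ 0` we have `‖e(t)‖² + ‖eA(t)‖² + ‖eB(t)‖² ≤ ‖e(0)‖² + ‖eA(0)‖² + ‖eB(0)‖²`;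
in particular all three error trajectories are bounded on `[0, ∞)`. -/
theorem adaptive_sync_errors_bounded (n : ℕ)
    (F H : ℝ → Matrix (Fin n) (Fin n) ℂ)
    (k₁ k₂ k₃ : Fin n → ℝ) (hk₁ : ∀ i, 0 < k₁ i)
    (K₁ K₂ K₃ : Matrix (Fin n) (Fin n) ℂ)
    (hK₁ : K₁ = Matrix.diagonal fun i => (k₁ i : ℂ))
    (hK₂ : K₂ = Matrix.diagonal fun i => (k₂ i : ℂ))
    (hK₃ : K₃ = Matrix.diagonal fun i => (k₃ i : ℂ))
    (e eA eB : ℝ → EuclideanSpace ℂ (Fin n))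
    (hde : ∀ t, HasDerivAt e
      (mulVecE (F t) (eA t) + mulVecE (H t) (eB t)
        - mulVecE K₁ (e t) - mulVecE K₂ (eA t) - mulVecE K₃ (eB t)) t)
    (hdeA : ∀ t, HasDerivAt eA (-(mulVecE (F t)ᴴ (e t)) + mulVecE K₂ (e t)) t)
    (hdeB : ∀ t, HasDerivAt eB (-(mulVecE (H t)ᴴ (e t)) + mulVecE K₃ (e t)) t) :
    (∀ t, 0 ≤ t →
      ‖e t‖ ^ 2 + ‖eA t‖ ^ 2 + ‖eB t‖ ^ 2 ≤ ‖e 0‖ ^ 2 + ‖eA 0‖ ^ 2 + ‖eB 0‖ ^ 2) ∧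
    ∃ C : ℝ, ∀ t, 0 ≤ t → ‖e t‖ ≤ C ∧ ‖eA t‖ ≤ C ∧ ‖eB t‖ ≤ C := by
  have hP : ∀ x, 0 ≤ inner ℝ x (mulVecE K₁ x) :=
    hK₁ ▸ real_inner_mulVecE_diagonal_self_nonneg fun i => (hk₁ i).le
  have hH₂ : K₂.IsHermitian := hK₂ ▸ isHermitian_diagonal_ofReal k₂
  have hH₃ : K₃.IsHermitian := hK₃ ▸ isHermitian_diagonal_ofReal k₃
  have hV : ∀ t, HasDerivAt (fun t => ‖e t‖ ^ 2 + ‖eA t‖ ^ 2 + ‖eB t‖ ^ 2)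
      (-(2 * inner ℝ (e t) (mulVecE K₁ (e t)))) t := by
    intro t
    refine (((hde t).norm_sq.add (hdeA t).norm_sq).add (hdeB t).norm_sq).congr_deriv ?_
    simp only [inner_add_right, inner_sub_right, inner_neg_right,
      real_inner_mulVecE_conjTranspose]
    rw [real_inner_mulVecE_comm_of_isHermitian hH₂ (eA t),
      real_inner_mulVecE_comm_of_isHermitian hH₃ (eB t)]
    ring
  have hanti : Antitone fun t => ‖e t‖ ^ 2 + ‖eA t‖ ^ 2 + ‖eB t‖ ^ 2 :=
    antitone_of_hasDerivAt_nonpos hV fun t =>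
      neg_nonpos.2 (mul_nonneg zero_le_two (hP (e t)))
  refine ⟨fun t ht => hanti ht, √(‖e 0‖ ^ 2 + ‖eA 0‖ ^ 2 + ‖eB 0‖ ^ 2), fun t ht => ?_⟩
  have h : ‖e t‖ ^ 2 + ‖eA t‖ ^ 2 + ‖eB t‖ ^ 2 ≤ ‖e 0‖ ^ 2 + ‖eA 0‖ ^ 2 + ‖eB 0‖ ^ 2 := hanti ht
  have h₁ := sq_nonneg ‖e t‖
  have h₂ := sq_nonneg ‖eA t‖
  have h₃ := sq_nonneg ‖eB t‖
  exact ⟨Real.le_sqrt_of_sq_le (by linarith), Real.le_sqrt_of_sq_le (by linarith),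
    Real.le_sqrt_of_sq_le (by linarith)⟩
end
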